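/- Let Γ be a countable discrete group generated by an infinite symmetric set S = {x₁, x₁⁻¹, x₂, x₂⁻¹, …} not containing e, with l₀(x_n) = l₀(x_n⁻¹) = n, and let l(g) be the infimum of Σ l₀(g_i) over all factorizations g = g₁⋯g_m with g_i ∈ S (and l(e)=0). Then l is a length function, the associated left invariant metric d(g,h)=l(g⁻¹h) is proper, and |{g ∈ Γ : d(g,e) ≤ n}| ≤ 3ⁿ for all n ∈ ℕ. -/

import Mathlib

/-- `g` is represented by a word of total weight `k`. -/
def HasWord {Γ : Type*} [Group Γ] (x : ℕ → Γ) (g : Γ) (k : ℕ) : Prop :=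
  ∃ L : List (ℕ × Bool), (∀ p ∈ L, 1 ≤ p.1) ∧
    (L.map fun p => if p.2 then x p.1 else (x p.1)⁻¹).prod = g ∧ (L.map fun p => p.1).sum = k

theorem HasWord.one {Γ : Type*} [Group Γ] (x : ℕ → Γ) : HasWord x 1 0 :=
  ⟨[], by simp, by simp, by simp⟩

theorem HasWord.mul {Γ : Type*} [Group Γ] {x : ℕ → Γ} {g h : Γ} {a b : ℕ}
    (hg : HasWord x g a) (hh : HasWord x h b) : HasWord x (g * h) (a + b) := by
  obtain ⟨L, h1, rfl, rfl⟩ := hg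
  obtain ⟨M, h2, rfl, rfl⟩ := hh
  refine ⟨L ++ M, ?_, by simp, by simp⟩
  intro p hp
  rcases List.mem_append.1 hp with hp | hp
  · exact h1 p hp
  · exact h2 p hp

theorem HasWord.gen {Γ : Type*} [Group Γ] (x : ℕ → Γ) (m : ℕ) (hm : 1 ≤ m) :
    HasWord x (x m) m := ⟨[(m, true)], by simpa using hm, by simp, by simp⟩

theorem HasWord.gen_inv {Γ : Type*} [Group Γ] (x : ℕ → Γ) (m : ℕ) (hm : 1 ≤ m) :
    HasWord x (x m)⁻¹ m := ⟨[(m, false)], by simpa using hm, by simp, by simp⟩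

/-- Case analysis on the first letter. -/
theorem HasWord.cases {Γ : Type*} [Group Γ] {x : ℕ → Γ} {g : Γ} {k : ℕ}
    (hg : HasWord x g k) : (g = 1 ∧ k = 0) ∨ ∃ m h j, 1 ≤ m ∧ HasWord x h j ∧ k = m + j ∧
      (g = x m * h ∨ g = (x m)⁻¹ * h) := by
  obtain ⟨L, h1, rfl, rfl⟩ := hg
  cases L with
  | nil => left; simp
  | cons p L =>
    right
    refine ⟨p.1, _, _, h1 p (by simp), ⟨L, fun q hq => h1 q (by simp [hq]), rfl, rfl⟩, by simp, ?_⟩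
    cases hp : p.2 <;> simp [hp]

theorem HasWord.inv {Γ : Type*} [Group Γ] {x : ℕ → Γ} {g : Γ} {k : ℕ}
    (hg : HasWord x g k) : HasWord x g⁻¹ k := by
  induction k using Nat.strong_induction_on generalizing g with
  | _ k ih =>
    rcases hg.cases with ⟨rfl, rfl⟩ | ⟨m, h, j, hm, hh, rfl, rfl | rfl⟩
    · simpa using HasWord.one x
    · have := (ih j (by omega) hh).mul (HasWord.gen_inv x m hm)
      rw [add_comm]; simpa using this
    · have := (ih j (by omega) hh).mul (HasWord.gen x m hm)
      rw [add_comm]; simpa using this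

theorem HasWord.ball {Γ : Type*} [Group Γ] (x : ℕ → Γ) (n : ℕ) :
    {g : Γ | ∃ k ≤ n, HasWord x g k}.Finite ∧
      {g : Γ | ∃ k ≤ n, HasWord x g k}.ncard ≤ 3 ^ n := by
  induction n using Nat.strong_induction_on with
  | _ n ih =>
    set B : ℕ → Set Γ := fun n => {g : Γ | ∃ k ≤ n, HasWord x g k} with hB
    set C : ℕ → Set Γ := fun i => (fun h => x (n - i) * h) '' B i ∪
      (fun h => (x (n - i))⁻¹ * h) '' B i with hC
    have hsub : B n ⊆ {1} ∪ ⋃ i ∈ Finset.range n, C i := by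
      rintro g ⟨k, hk, hg⟩
      rcases hg.cases with ⟨rfl, rfl⟩ | ⟨m, h, j, hm, hh, rfl, hgm⟩
      · simp
      · right
        simp only [Set.mem_iUnion]
        refine ⟨n - m, by simp; omega, ?_⟩
        have e : n - (n - m) = m := by omega
        have hb : h ∈ B (n - m) := ⟨j, by omega, hh⟩
        simp only [hC, e]
        rcases hgm with rfl | rfl
        · exact Or.inl ⟨h, hb, rfl⟩
        · exact Or.inr ⟨h, hb, rfl⟩
    have hCf : ∀ i ∈ Finset.range n, (C i).Finite := fun i hi =>
      ((ih i (by simpa using hi)).1.image _).union ((ih i (by simpa using hi)).1.image _)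
    have hCc : ∀ i ∈ Finset.range n, (C i).ncard ≤ 2 * 3 ^ i := fun i hi => by
      obtain ⟨hf, hc⟩ := ih i (by simpa using hi)
      have h1 := Set.ncard_union_le ((fun h => x (n - i) * h) '' B i)
        ((fun h => (x (n - i))⁻¹ * h) '' B i)
      have h2 := Set.ncard_image_le (f := fun h => x (n - i) * h) hf
      have h3 := Set.ncard_image_le (f := fun h => (x (n - i))⁻¹ * h) hf
      simp only [hC, hB] at *
      omega
    have hf : ({1} ∪ ⋃ i ∈ Finset.range n, C i).Finite :=
      (Set.finite_singleton _).union (Set.Finite.biUnion (Finset.finite_toSet _) hCf)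
    refine ⟨hf.subset hsub, ?_⟩
    have hgeo : ∀ n : ℕ, 1 + ∑ i ∈ Finset.range n, 2 * 3 ^ i = 3 ^ n := fun n => by
      induction n with
      | zero => simp
      | succ n ih => rw [Finset.sum_range_succ, ← add_assoc, ih, pow_succ]; ring
    calc (B n).ncard ≤ _ := Set.ncard_le_ncard hsub hf
      _ ≤ _ := Set.ncard_union_le _ _
      _ ≤ 1 + ∑ i ∈ Finset.range n, (C i).ncard := by
          rw [Set.ncard_singleton]
          exact Nat.add_le_add_left (Finset.set_ncard_biUnion_le _ _) _
      _ ≤ 1 + ∑ i ∈ Finset.range n, 2 * 3 ^ i := Nat.add_le_add_left (Finset.sum_le_sum hCc) _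
      _ = 3 ^ n := hgeo n


/-- Let `Γ` be a countable discrete group generated by an infinite symmetric set
`S = {x₁, x₁⁻¹, x₂, x₂⁻¹, …}` not containing `e`, with weights
`l₀(x_n) = l₀(x_n⁻¹) = n`, and let `l(g)` be the infimum of `Σ l₀(g_i)` over all
factorizations `g = g₁⋯g_m` with `g_i ∈ S` (and `l(e) = 0`). Then `l` is a
length function, the associated left invariant metric `d(g,h) = l(g⁻¹h)` is
proper, and `|{g : d(g,e) ≤ n}| ≤ 3ⁿ` for all `n`. -/
theorem stmt15 {Γ : Type*} [Group Γ] [Countable Γ] [DecidableEq Γ]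
    (x : ℕ → Γ)
    (S : Set Γ) (hS : S = {g : Γ | ∃ m : ℕ, 1 ≤ m ∧ (g = x m ∨ g = (x m)⁻¹)})
    (hSe : (1 : Γ) ∉ S)
    (hSinf : S.Infinite)
    (hSgen : Subgroup.closure S = ⊤)
    (l : Γ → ℝ)
    (hl : ∀ g : Γ, l g = if g = 1 then 0 else
      sInf {r : ℝ | ∃ L : List (ℕ × Bool), (∀ p ∈ L, 1 ≤ p.1) ∧
        (L.map fun p => if p.2 then x p.1 else (x p.1)⁻¹).prod = g ∧
        r = (L.map fun p => (p.1 : ℝ)).sum}) :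
    -- l is a length function
    (∀ g : Γ, 0 ≤ l g) ∧
    (∀ g : Γ, l g = 0 ↔ g = 1) ∧
    (∀ g : Γ, l g⁻¹ = l g) ∧
    (∀ g h : Γ, l (g * h) ≤ l g + l h) ∧
    -- the associated left invariant metric d(g,h) = l(g⁻¹h) is proper
    (∀ r : ℝ, ({g : Γ | l g ≤ r}).Finite) ∧
    -- |D(e,n)| ≤ 3ⁿ
    (∀ n : ℕ, ({g : Γ | l g ≤ (n : ℝ)}).ncard ≤ 3 ^ n) := by
  have hex : ∀ g : Γ, ∃ k, HasWord x g k := by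
    intro g
    have hg : g ∈ Subgroup.closure S := by rw [hSgen]; trivial
    induction hg using Subgroup.closure_induction with
    | mem g hg =>
      rw [hS] at hg
      obtain ⟨m, hm, rfl | rfl⟩ := hg
      · exact ⟨m, HasWord.gen x m hm⟩
      · exact ⟨m, HasWord.gen_inv x m hm⟩
    | one => exact ⟨0, HasWord.one x⟩
    | mul a b _ _ ha hb =>
      obtain ⟨k, hk⟩ := ha
      obtain ⟨j, hj⟩ := hb
      exact ⟨_, hk.mul hj⟩
    | inv a _ ha =>
      obtain ⟨k, hk⟩ := ha
      exact ⟨_, hk.inv⟩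
  have key : ∀ g : Γ, ∃ k : ℕ, l g = k ∧ HasWord x g k ∧ ∀ j, HasWord x g j → k ≤ j := by
    intro g
    classical
    by_cases h1 : g = 1
    · subst h1
      exact ⟨0, by simp [hl], HasWord.one x, fun j _ => Nat.zero_le _⟩
    · refine ⟨Nat.find (hex g), ?_, Nat.find_spec (hex g), fun j hj => Nat.find_min' _ hj⟩
      rw [hl, if_neg h1]
      have hcast : ∀ L : List (ℕ × Bool), (L.map fun p => (p.1 : ℝ)).sum
          = (((L.map fun p => p.1).sum : ℕ) : ℝ) := fun L => by
        induction L with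
        | nil => simp
        | cons a L ih => simp [ih]
      apply IsLeast.csInf_eq
      constructor
      · obtain ⟨L, a, b, c⟩ := Nat.find_spec (hex g)
        exact ⟨L, a, b, by rw [hcast, c]⟩
      · rintro r ⟨L, a, b, rfl⟩
        rw [hcast]
        exact_mod_cast Nat.find_min' (hex g) ⟨L, a, b, rfl⟩
  have hball : ∀ n : ℕ, {g : Γ | l g ≤ (n : ℝ)} ⊆ {g : Γ | ∃ k ≤ n, HasWord x g k} := by
    intro n g hg
    obtain ⟨k, hk, hw, _⟩ := key g
    rw [Set.mem_ofPred_eq, hk] at hg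
    exact ⟨k, by exact_mod_cast hg, hw⟩
  have hinv : ∀ g : Γ, l g⁻¹ ≤ l g := by
    intro g
    obtain ⟨k, hk, hw, _⟩ := key g
    obtain ⟨j, hj, _, hm⟩ := key g⁻¹
    rw [hk, hj]
    exact_mod_cast hm k hw.inv
  refine ⟨?_, ?_, ?_, ?_, ?_, ?_⟩
  · intro g
    obtain ⟨k, hk, _⟩ := key g
    rw [hk]; positivity
  · intro g
    constructor
    · intro h0
      obtain ⟨k, hk, hw, _⟩ := key g
      have hk0 : k = 0 := by rw [hk] at h0; exact_mod_cast h0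
      rcases hw.cases with ⟨h, _⟩ | ⟨m, _, _, hm, _, he, _⟩
      · exact h
      · omega
    · rintro rfl
      simp [hl]
  · intro g
    refine le_antisymm (hinv g) ?_
    simpa using hinv g⁻¹
  · intro g h
    obtain ⟨a, ha, hwa, _⟩ := key g
    obtain ⟨b, hb, hwb, _⟩ := key h
    obtain ⟨c, hc, _, hm⟩ := key (g * h)
    rw [ha, hb, hc]
    exact_mod_cast hm _ (hwa.mul hwb)
  · intro r
    obtain ⟨n, hn⟩ := exists_nat_ge r
    exact (HasWord.ball x n).1.subset (fun g (hg : l g ≤ r) => hball n (le_trans hg hn))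
  · intro n
    exact (Set.ncard_le_ncard (hball n) (HasWord.ball x n).1).trans (HasWord.ball x n).2
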